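/- There exist δ₀ > 0 and C > 0 with the following property. For every x₀ ∈ ℝ and every continuous m : ℝ → ℝ with δ := sup_{x} |m(x) − tanh(x − x₀)| ≤ δ₀, the unique center ζ of m (i.e., the unique ζ with ∫ (m(x) − tanh(x−ζ)) sech²(x−ζ) dx = 0) satisfies ζ = x₀ − (3/4) ⟨m − m̄_{x₀}, m̄'_{x₀}⟩ − (9/16) ⟨m − m̄_{x₀}, m̄'_{x₀}⟩ ⟨m − m̄_{x₀}, m̄''_{x₀}⟩ + R, where |R| ≤ C δ³. -/

import Mathlib

open MeasureTheory Real

/-- `⟨m − m̄_{x₀}, m̄'_{x₀}⟩` with `m̄_{x₀}(x) = tanh(x−x₀)`, `m̄'_{x₀}(x) = sech²(x−x₀)`. -/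
noncomputable def pairing₁ (m : ℝ → ℝ) (x₀ : ℝ) : ℝ :=
  ∫ x : ℝ, (m x - Real.tanh (x - x₀)) * (1 / Real.cosh (x - x₀) ^ 2)

/-- `⟨m − m̄_{x₀}, m̄''_{x₀}⟩` with `m̄''_{x₀}(x) = −2 sech²(x−x₀) tanh(x−x₀)`. -/
noncomputable def pairing₂ (m : ℝ → ℝ) (x₀ : ℝ) : ℝ :=
  ∫ x : ℝ, (m x - Real.tanh (x - x₀)) *
    (-2 * (1 / Real.cosh (x - x₀) ^ 2) * Real.tanh (x - x₀))

open Filter Topology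

theorem hasDerivAt_tanh (x : ℝ) : HasDerivAt Real.tanh (1 / cosh x ^ 2) x := by
  have h := (hasDerivAt_sinh x).div (hasDerivAt_cosh x) (cosh_pos x).ne'
  have e : (Real.sinh / Real.cosh : ℝ → ℝ) = Real.tanh := by
    ext y; simp [tanh_eq_sinh_div_cosh]
  rw [e] at h
  convert! h using 1
  rw [← cosh_sq_sub_sinh_sq x]
  ring

theorem continuous_tanh : Continuous Real.tanh :=
  continuous_iff_continuousAt.2 fun x => (hasDerivAt_tanh x).continuousAt

theorem one_div_cosh_sq (x : ℝ) : 1 / cosh x ^ 2 = 1 - tanh x ^ 2 := by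
  have h := (cosh_pos x).ne'
  have h2 := cosh_sq_sub_sinh_sq x
  rw [tanh_eq_sinh_div_cosh]
  field_simp
  linarith

theorem tendsto_tanh_atTop : Tendsto Real.tanh atTop (𝓝 1) := by
  have h : Tendsto (fun x : ℝ => exp (-(2 * x))) atTop (𝓝 0) :=
    tendsto_exp_neg_atTop_nhds_zero.comp (tendsto_id.const_mul_atTop two_pos)
  have h2 : Tendsto (fun x : ℝ => (1 - exp (-(2 * x))) / (1 + exp (-(2 * x)))) atTop
      (𝓝 ((1 - 0) / (1 + 0))) :=
    (tendsto_const_nhds.sub h).div (tendsto_const_nhds.add h) (by norm_num)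
  have e : (fun x : ℝ => (1 - exp (-(2 * x))) / (1 + exp (-(2 * x)))) = Real.tanh := by
    ext x
    have e1 : exp (-(2 * x)) = exp (-x) * exp (-x) := by rw [← exp_add]; ring_nf
    have e2 : exp x * exp (-x) = 1 := by rw [← exp_add]; simp
    have := exp_pos x
    have := exp_pos (-x)
    rw [tanh_eq, e1, div_eq_div_iff (by positivity) (by positivity)]
    linear_combination (2 * exp (-x)) * (-e2)
  rw [e] at h2
  simpa using h2

theorem tendsto_tanh_atBot : Tendsto Real.tanh atBot (𝓝 (-1)) := by
  have h := (tendsto_tanh_atTop.comp tendsto_neg_atBot_atTop).neg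
  simpa [Function.comp_def, tanh_neg] using h

theorem tanh_add (x y : ℝ) :
    tanh (x + y) = (tanh x + tanh y) / (1 + tanh x * tanh y) := by
  have hx := (cosh_pos x).ne'
  have hy := (cosh_pos y).ne'
  have hxy := (cosh_pos (x + y)).ne'
  have h : 1 + tanh x * tanh y = cosh (x + y) / (cosh x * cosh y) := by
    rw [cosh_add, tanh_eq_sinh_div_cosh, tanh_eq_sinh_div_cosh]; field_simp
  have h2 : tanh x + tanh y = sinh (x + y) / (cosh x * cosh y) := by
    rw [sinh_add, tanh_eq_sinh_div_cosh, tanh_eq_sinh_div_cosh]; field_simp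
  rw [h, h2, tanh_eq_sinh_div_cosh]
  field_simp

theorem abs_tanh_mul_le (x k : ℝ) : |tanh x * k| ≤ |k| := by
  rw [abs_mul]
  exact mul_le_of_le_one_left (abs_nonneg k) (abs_tanh_lt_one x).le

theorem abs_tanh_mul_tanh_lt_one (x y : ℝ) : |tanh x * tanh y| < 1 :=
  (abs_tanh_mul_le x _).trans_lt (abs_tanh_lt_one y)

theorem one_div_cosh_sub_sq (x ζ : ℝ) :
    1 / cosh (x - ζ) ^ 2 =
      (1 - tanh ζ ^ 2) * (1 / (1 - tanh x * tanh ζ) ^ 2 * (1 / cosh x ^ 2)) := by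
  have h := tanh_add x (-ζ)
  rw [← sub_eq_add_neg, tanh_neg] at h
  have h3 : 1 - tanh x * tanh ζ ≠ 0 := by
    have := (abs_lt.1 (abs_tanh_mul_tanh_lt_one x ζ)).2
    linarith
  rw [one_div_cosh_sq, one_div_cosh_sq, h,
    show 1 + tanh x * -tanh ζ = 1 - tanh x * tanh ζ by ring]
  field_simp
  ring

theorem integrable_one_div_cosh_sq : Integrable fun x : ℝ => 1 / cosh x ^ 2 := by
  refine integrable_inv_one_add_sq.mono' ?_ (ae_of_all _ fun x => ?_)
  · exact (continuous_const.div (continuous_cosh.pow 2)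
      fun x => (pow_pos (cosh_pos x) 2).ne').aestronglyMeasurable
  · rw [norm_of_nonneg (by positivity), one_div]
    refine inv_anti₀ (by positivity) ?_
    have h : x ^ 2 ≤ sinh x ^ 2 := by
      rw [sq_le_sq, abs_sinh]
      exact self_le_sinh_iff.2 (abs_nonneg x)
    rw [cosh_sq]
    linarith

/-- The measure on `ℝ` with density `sech²`. -/
noncomputable def sechSqMeasure : Measure ℝ :=
  volume.withDensity fun x => ENNReal.ofReal (1 / cosh x ^ 2)

instance : IsFiniteMeasure sechSqMeasure :=
  isFiniteMeasure_withDensity_ofReal integrable_one_div_cosh_sq.2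

theorem integral_sechSqMeasure (g : ℝ → ℝ) :
    ∫ x, g x ∂sechSqMeasure = ∫ x, g x * (1 / cosh x ^ 2) := by
  have hm : Measurable fun x : ℝ => ENNReal.ofReal (1 / cosh x ^ 2) :=
    (measurable_const.div (measurable_cosh.pow_const 2)).ennreal_ofReal
  rw [sechSqMeasure, integral_withDensity_eq_integral_toReal_smul hm (by simp)]
  refine integral_congr_ae (ae_of_all _ fun x => ?_)
  simp only [smul_eq_mul]
  rw [ENNReal.toReal_ofReal (by positivity), mul_comm]

theorem integrable_sechSqMeasure_of_abs_le {g : ℝ → ℝ} (hg : Continuous g) {B : ℝ}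
    (hB : ∀ x, |g x| ≤ B) : Integrable g sechSqMeasure :=
  Integrable.of_bound hg.aestronglyMeasurable B (ae_of_all _ hB)

theorem integral_tanh_pow (n : ℕ) :
    ∫ x, tanh x ^ n ∂sechSqMeasure = (1 - (-1) ^ (n + 1)) / (n + 1) := by
  have hn : (n + 1 : ℝ) ≠ 0 := by positivity
  rw [integral_sechSqMeasure, sub_div]
  refine integral_of_hasDerivAt_of_tendsto (f := fun x => tanh x ^ (n + 1) / (n + 1))
    (fun x => ?_) ?_ ?_ ?_
  · have h := ((hasDerivAt_tanh x).pow (n + 1)).div_const (n + 1 : ℝ)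
    convert! h using 1
    push_cast
    field_simp
  · refine integrable_one_div_cosh_sq.bdd_mul (c := 1)
      (continuous_tanh.pow n).aestronglyMeasurable (ae_of_all _ fun x => ?_)
    rw [norm_pow]
    exact pow_le_one₀ (norm_nonneg _) (abs_tanh_lt_one x).le
  · exact (tendsto_tanh_atBot.pow (n + 1)).div_const _
  · simpa using (tendsto_tanh_atTop.pow (n + 1)).div_const (n + 1 : ℝ)

theorem sechSqMeasure_real_univ : sechSqMeasure.real Set.univ = 2 := by
  have h := integral_tanh_pow 0
  norm_num at h
  exact h

theorem abs_integral_sechSqMeasure_le {g : ℝ → ℝ} {B : ℝ} (hB : ∀ x, |g x| ≤ B) :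
    |∫ x, g x ∂sechSqMeasure| ≤ 2 * B := by
  have h := norm_integral_le_of_norm_le_const (μ := sechSqMeasure) (f := g) (C := B)
    (ae_of_all _ fun x => hB x)
  rw [sechSqMeasure_real_univ, norm_eq_abs] at h
  linarith

theorem integral_tanh_sechSqMeasure : ∫ x, tanh x ∂sechSqMeasure = 0 := by
  simpa using integral_tanh_pow 1

theorem integral_tanh_sq_sechSqMeasure : ∫ x, tanh x ^ 2 ∂sechSqMeasure = 2 / 3 := by
  have h := integral_tanh_pow 2
  norm_num at h
  exact h

theorem integral_tanh_cube_sechSqMeasure : ∫ x, tanh x ^ 3 ∂sechSqMeasure = 0 := by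
  have h := integral_tanh_pow 3
  norm_num at h
  exact h

/-- The defining function of the center of `tanh + ψ`, in the variable `k = tanh ζ` and up to
the factor `1 - k ^ 2`. -/
noncomputable def centerFun (ψ : ℝ → ℝ) (k : ℝ) : ℝ :=
  ∫ x, (tanh x + ψ x) * (1 / (1 - tanh x * k) ^ 2) ∂sechSqMeasure

section

variable {ψ : ℝ → ℝ} {δ k : ℝ}

theorem one_sub_tanh_mul_ne_zero (hk : |k| < 1) (x : ℝ) : 1 - tanh x * k ≠ 0 := by
  have := (abs_le.1 (abs_tanh_mul_le x k)).2
  have := le_abs_self k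
  linarith

theorem continuous_one_div_one_sub_tanh_mul_sq (hk : |k| < 1) :
    Continuous fun x => 1 / (1 - tanh x * k) ^ 2 :=
  continuous_const.div ((continuous_const.sub (continuous_tanh.mul continuous_const)).pow 2)
    fun x => pow_ne_zero 2 (one_sub_tanh_mul_ne_zero hk x)

theorem integral_center_eq_centerFun (hψ : Continuous ψ) (hδ : ∀ x, |ψ x| ≤ δ) (ζ : ℝ) :
    ∫ x, (tanh x + ψ x - tanh (x - ζ)) * (1 / cosh (x - ζ) ^ 2) =
      (1 - tanh ζ ^ 2) * centerFun ψ (tanh ζ) := by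
  have hs : Integrable fun x : ℝ => 1 / cosh (x - ζ) ^ 2 :=
    integrable_one_div_cosh_sq.comp_sub_right ζ
  have h1 : Integrable fun x => (tanh x + ψ x) * (1 / cosh (x - ζ) ^ 2) := by
    refine hs.bdd_mul (c := 1 + δ) (continuous_tanh.add hψ).aestronglyMeasurable
      (ae_of_all _ fun x => ?_)
    exact (norm_add_le _ _).trans (add_le_add (abs_tanh_lt_one x).le (hδ x))
  have h2 : Integrable fun x => tanh (x - ζ) * (1 / cosh (x - ζ) ^ 2) := by
    refine hs.bdd_mul (c := 1)
      (continuous_tanh.comp (continuous_sub_right ζ)).aestronglyMeasurable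
      (ae_of_all _ fun x => (abs_tanh_lt_one _).le)
  simp_rw [fun x => sub_mul (tanh x + ψ x) (tanh (x - ζ))]
  rw [integral_sub h1 h2, integral_sub_right_eq_self (fun x => tanh x * (1 / cosh x ^ 2)) ζ,
    ← integral_sechSqMeasure, integral_tanh_sechSqMeasure, sub_zero, centerFun,
    integral_sechSqMeasure, ← integral_const_mul]
  refine integral_congr_ae (ae_of_all _ fun x => ?_)
  simp only [one_div_cosh_sub_sq x ζ]
  ring

theorem abs_tanh_le_of_integral_center_eq_zero (hψ : Continuous ψ) (hδ : ∀ x, |ψ x| ≤ δ)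
    {ζ : ℝ} (h : ∫ x, (tanh x + ψ x - tanh (x - ζ)) * (1 / cosh (x - ζ) ^ 2) = 0) :
    |tanh ζ| ≤ 3 * δ := by
  set k := tanh ζ with hk
  have hpos : ∀ x, 0 < 1 + tanh x * k := fun x => by
    have := (abs_lt.1 (abs_tanh_mul_tanh_lt_one x ζ)).1
    linarith
  have hlt : ∀ x, 1 + tanh x * k < 2 := fun x => by
    have := (abs_lt.1 (abs_tanh_mul_tanh_lt_one x ζ)).2
    linarith
  have hub : ∀ x, (1 - tanh x ^ 2) / (1 + tanh x * k) ≤ 2 := fun x => by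
    rw [div_le_iff₀ (hpos x)]
    have h1 := neg_abs_le (tanh x * k)
    have h2 : |tanh x * k| ≤ |tanh x| := by
      rw [abs_mul]; exact mul_le_of_le_one_right (abs_nonneg _) (abs_tanh_lt_one ζ).le
    have h3 := abs_tanh_lt_one x
    rw [← sq_abs (tanh x)]
    nlinarith [abs_nonneg (tanh x)]
  have hnn : ∀ x, 0 ≤ (1 - tanh x ^ 2) / (1 + tanh x * k) := fun x =>
    div_nonneg (by linarith [tanh_sq_lt_one x]) (hpos x).le
  have i1 : Integrable (fun x => ψ (x + ζ)) sechSqMeasure :=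
    integrable_sechSqMeasure_of_abs_le (hψ.comp (continuous_add_const ζ)) fun x => hδ _
  have i2 : Integrable (fun x => (1 - tanh x ^ 2) / (1 + tanh x * k)) sechSqMeasure := by
    refine integrable_sechSqMeasure_of_abs_le (B := 2) ?_ fun x => ?_
    · exact (continuous_const.sub (continuous_tanh.pow 2)).div
        (continuous_const.add (continuous_tanh.mul continuous_const)) fun x => (hpos x).ne'
    · rw [abs_of_nonneg (hnn x)]; exact hub x
  have key : (∫ x, ψ (x + ζ) ∂sechSqMeasure) +
      k * ∫ x, (1 - tanh x ^ 2) / (1 + tanh x * k) ∂sechSqMeasure = 0 := by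
    rw [← integral_const_mul, ← integral_add i1 (i2.const_mul k), integral_sechSqMeasure, ← h,
      ← integral_add_right_eq_self
        (fun x => (tanh x + ψ x - tanh (x - ζ)) * (1 / cosh (x - ζ) ^ 2)) ζ]
    refine integral_congr_ae (ae_of_all _ fun x => ?_)
    simp only [add_sub_cancel_right]
    rw [tanh_add, ← hk]
    have hne := (hpos x).ne'
    have e : k * ((1 - tanh x ^ 2) / (1 + tanh x * k)) =
        (tanh x + k) / (1 + tanh x * k) - tanh x := by
      rw [eq_sub_iff_add_eq, mul_div_assoc', div_add' _ _ _ hne, div_left_inj' hne]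
      ring
    linear_combination 1 / cosh x ^ 2 * e
  have hlow : 2 / 3 ≤ ∫ x, (1 - tanh x ^ 2) / (1 + tanh x * k) ∂sechSqMeasure := by
    have it : Integrable (fun x => tanh x ^ 2) sechSqMeasure :=
      integrable_sechSqMeasure_of_abs_le (B := 1) (continuous_tanh.pow 2) fun x => by
        rw [abs_of_nonneg (sq_nonneg _)]; exact (tanh_sq_lt_one x).le
    have e : ∫ x, (1 - tanh x ^ 2) / 2 ∂sechSqMeasure = 2 / 3 := by
      rw [integral_div, integral_sub (integrable_const _) it, integral_tanh_sq_sechSqMeasure,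
        integral_const, sechSqMeasure_real_univ]
      norm_num
    rw [← e]
    refine integral_mono (((integrable_const _).sub it).div_const 2) i2 fun x => ?_
    exact div_le_div_of_nonneg_left (by linarith [tanh_sq_lt_one x]) (hpos x) (hlt x).le
  have hψi := abs_integral_sechSqMeasure_le (g := fun x => ψ (x + ζ)) fun x => hδ _
  rw [eq_neg_of_add_eq_zero_left key, abs_neg, abs_mul] at hψi
  have := le_abs_self (∫ x, (1 - tanh x ^ 2) / (1 + tanh x * k) ∂sechSqMeasure)
  nlinarith [abs_nonneg k]

theorem mul_le_mul_one_div_sq_sub {t p k l : ℝ} (ht : |t| ≤ 1) (hp : |p| ≤ δ)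
    (hk : |k| ≤ 1 / 2) (hl : |l| ≤ 1 / 2) (hlk : l ≤ k) :
    (k - l) * (t ^ 2 / 4 - 16 * δ) ≤
      (t + p) * (1 / (1 - t * k) ^ 2) - (t + p) * (1 / (1 - t * l) ^ 2) := by
  have bound : ∀ j : ℝ, |j| ≤ 1 / 2 → 1 / 2 ≤ 1 - t * j ∧ 1 - t * j ≤ 3 / 2 := fun j hj => by
    have h : |t * j| ≤ 1 / 2 := by
      rw [abs_mul]
      nlinarith [abs_nonneg t, abs_nonneg j]
    have := abs_le.1 h
    constructor <;> linarith
  obtain ⟨hA, hA'⟩ := bound k hk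
  obtain ⟨hB, hB'⟩ := bound l hl
  set A := 1 - t * k with hAdef
  set B := 1 - t * l with hBdef
  have hA0 : 0 < A := by linarith
  have hB0 : 0 < B := by linarith
  set W := (A + B) / (A ^ 2 * B ^ 2) with hW
  have e : (t + p) * (1 / A ^ 2) - (t + p) * (1 / B ^ 2) = (k - l) * ((t ^ 2 + t * p) * W) := by
    have : B - A = t * (k - l) := by rw [hAdef, hBdef]; ring
    have e2 : 1 / A ^ 2 - 1 / B ^ 2 = (B - A) * W := by
      rw [hW]; field_simp; ring
    rw [← mul_sub, e2, this]; ring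
  have hABl : 1 / 4 ≤ A * B := by nlinarith
  have hABu : A * B ≤ 9 / 4 := by nlinarith
  have hW1 : 1 / 4 ≤ W := by
    rw [hW, le_div_iff₀ (by positivity)]
    have h1 : A * B * (A * B) ≤ 9 / 4 * (A * B) := by nlinarith
    have h2 : A * B ≤ 3 / 4 * (A + B) := by nlinarith
    nlinarith
  have hW2 : W ≤ 16 := by
    rw [hW, div_le_iff₀ (by positivity)]
    have h1 : 1 / 4 * (A * B) ≤ A * B * (A * B) := by nlinarith
    have h2 : A + B ≤ 4 * (A * B) := by nlinarith
    nlinarith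
  have htp : |t * p| ≤ δ := by
    rw [abs_mul]
    nlinarith [abs_nonneg t, abs_nonneg p]
  have htp' := (abs_le.1 htp).1
  have hδ0 : 0 ≤ δ := (abs_nonneg p).trans hp
  rw [e]
  refine mul_le_mul_of_nonneg_left ?_ (by linarith)
  nlinarith [sq_nonneg t]

theorem abs_centerFun_integrand_le (hδ : ∀ x, |ψ x| ≤ δ) (hk : |k| ≤ 1 / 2) (x : ℝ) :
    |(tanh x + ψ x) * (1 / (1 - tanh x * k) ^ 2)| ≤ (1 + δ) * 4 := by
  have h1 : |tanh x + ψ x| ≤ 1 + δ :=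
    (abs_add_le _ _).trans (add_le_add (abs_tanh_lt_one x).le (hδ x))
  have h2 := (abs_le.1 (abs_tanh_mul_le x k)).2
  rw [abs_mul]
  refine mul_le_mul h1 ?_ (abs_nonneg _) ((abs_nonneg _).trans h1)
  rw [abs_of_nonneg (by positivity), div_le_iff₀ (by nlinarith)]
  nlinarith

theorem integrable_centerFun_integrand (hψ : Continuous ψ) (hδ : ∀ x, |ψ x| ≤ δ)
    (hk : |k| ≤ 1 / 2) :
    Integrable (fun x => (tanh x + ψ x) * (1 / (1 - tanh x * k) ^ 2)) sechSqMeasure :=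
  integrable_sechSqMeasure_of_abs_le
    ((continuous_tanh.add hψ).mul (continuous_one_div_one_sub_tanh_mul_sq (by linarith)))
    (abs_centerFun_integrand_le hδ hk)

theorem continuousOn_centerFun (hψ : Continuous ψ) (hδ : ∀ x, |ψ x| ≤ δ) :
    ContinuousOn (centerFun ψ) (Set.Icc (-(1 / 2)) (1 / 2)) := by
  refine continuousOn_of_dominated (bound := fun _ => (1 + δ) * 4)
    (fun k hk => (integrable_centerFun_integrand hψ hδ (abs_le.2 hk)).aestronglyMeasurable)
    (fun k hk => ae_of_all _ (abs_centerFun_integrand_le hδ (abs_le.2 hk)))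
    (integrable_const _) (ae_of_all _ fun x => ?_)
  refine continuousOn_const.mul (continuousOn_const.div (by fun_prop) fun k hk => ?_)
  have := abs_le.2 hk
  exact pow_ne_zero 2 (one_sub_tanh_mul_ne_zero (by linarith) x)

theorem sub_div_le_centerFun_sub {l : ℝ} (hψ : Continuous ψ) (hδ : ∀ x, |ψ x| ≤ δ)
    (hδ₀ : δ ≤ 1 / 400) (hk : |k| ≤ 1 / 2) (hl : |l| ≤ 1 / 2) (hlk : l ≤ k) :
    (k - l) / 12 ≤ centerFun ψ k - centerFun ψ l := by
  have ik := integrable_centerFun_integrand hψ hδ hk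
  have il := integrable_centerFun_integrand hψ hδ hl
  have it : Integrable (fun x => tanh x ^ 2 / 4) sechSqMeasure :=
    (integrable_sechSqMeasure_of_abs_le (B := 1) (continuous_tanh.pow 2) fun x => by
      rw [abs_of_nonneg (sq_nonneg _)]; exact (tanh_sq_lt_one x).le).div_const 4
  rw [centerFun, centerFun, ← integral_sub ik il]
  have h : ∫ x, (k - l) * (tanh x ^ 2 / 4 - 16 * δ) ∂sechSqMeasure =
      (k - l) * (1 / 6 - 32 * δ) := by
    rw [integral_const_mul, integral_sub it (integrable_const _), integral_div,
      integral_tanh_sq_sechSqMeasure, integral_const, sechSqMeasure_real_univ, smul_eq_mul]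
    ring
  calc (k - l) / 12 ≤ (k - l) * (1 / 6 - 32 * δ) := by nlinarith
    _ = _ := h.symm
    _ ≤ _ := integral_mono ((it.sub (integrable_const _)).const_mul _) (ik.sub il) fun x =>
      mul_le_mul_one_div_sq_sub (abs_tanh_lt_one x).le (hδ x) hk hl hlk

theorem exists_centerFun_eq_zero (hψ : Continuous ψ) (hδ : ∀ x, |ψ x| ≤ δ)
    (hδ₀ : δ ≤ 1 / 400) : ∃ k, |k| ≤ 1 / 2 ∧ centerFun ψ k = 0 := by
  have h0 : |centerFun ψ 0| ≤ 2 * δ := by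
    have it : Integrable tanh sechSqMeasure :=
      integrable_sechSqMeasure_of_abs_le continuous_tanh fun x => (abs_tanh_lt_one x).le
    have e : centerFun ψ 0 = ∫ x, ψ x ∂sechSqMeasure := by
      simp only [centerFun, mul_zero, sub_zero, one_pow, div_one, mul_one]
      rw [integral_add it (integrable_sechSqMeasure_of_abs_le hψ hδ),
        integral_tanh_sechSqMeasure, zero_add]
    rw [e]
    exact abs_integral_sechSqMeasure_le hδ
  obtain ⟨h0l, h0r⟩ := abs_le.1 h0
  have z : |(0 : ℝ)| ≤ 1 / 2 := by norm_num
  have p : |(1 / 2 : ℝ)| ≤ 1 / 2 := by norm_num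
  have n : |(-(1 / 2) : ℝ)| ≤ 1 / 2 := by norm_num
  have hp := sub_div_le_centerFun_sub hψ hδ hδ₀ p z (by norm_num)
  have hn := sub_div_le_centerFun_sub hψ hδ hδ₀ z n (by norm_num)
  obtain ⟨k, hk, hk0⟩ := intermediate_value_Icc (by norm_num) (continuousOn_centerFun hψ hδ)
    (show (0 : ℝ) ∈ Set.Icc _ _ from ⟨by linarith, by linarith⟩)
  exact ⟨k, abs_le.2 hk, hk0⟩

theorem centerFun_injOn {l : ℝ} (hψ : Continuous ψ) (hδ : ∀ x, |ψ x| ≤ δ)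
    (hδ₀ : δ ≤ 1 / 400) (hk : |k| ≤ 1 / 2) (hl : |l| ≤ 1 / 2)
    (h : centerFun ψ k = centerFun ψ l) : k = l := by
  rcases le_total l k with hlk | hlk
  · have := sub_div_le_centerFun_sub hψ hδ hδ₀ hk hl hlk
    linarith
  · have := sub_div_le_centerFun_sub hψ hδ hδ₀ hl hk hlk
    linarith

theorem abs_centerFun_sub_le (hψ : Continuous ψ) (hδ : ∀ x, |ψ x| ≤ δ) (hk : |k| ≤ 1 / 2) :
    |centerFun ψ k - (4 / 3 * k + (∫ x, ψ x ∂sechSqMeasure) +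
      2 * k * ∫ x, ψ x * tanh x ∂sechSqMeasure)| ≤ 44 * |k| ^ 3 + 32 * δ * k ^ 2 := by
  have tpow : ∀ n : ℕ, Integrable (fun x => tanh x ^ n) sechSqMeasure := fun n =>
    integrable_sechSqMeasure_of_abs_le (B := 1) (continuous_tanh.pow n) fun x => by
      rw [abs_pow]; exact pow_le_one₀ (abs_nonneg _) (abs_tanh_lt_one x).le
  have iψ : Integrable ψ sechSqMeasure := integrable_sechSqMeasure_of_abs_le hψ hδ
  have hδ0 : 0 ≤ δ := (abs_nonneg _).trans (hδ 0)
  have iψt : Integrable (fun x => ψ x * tanh x) sechSqMeasure :=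
    integrable_sechSqMeasure_of_abs_le (B := δ) (hψ.mul continuous_tanh) fun x => by
      rw [abs_mul]
      nlinarith [hδ x, abs_tanh_lt_one x, abs_nonneg (ψ x), abs_nonneg (tanh x)]
  have it : Integrable tanh sechSqMeasure := by simpa using tpow 1
  have ip : Integrable (fun x => tanh x + 2 * k * tanh x ^ 2 + 3 * k ^ 2 * tanh x ^ 3)
      sechSqMeasure := (it.add ((tpow 2).const_mul _)).add ((tpow 3).const_mul _)
  have iq : Integrable (fun x => ψ x + 2 * k * (ψ x * tanh x)) sechSqMeasure :=
    iψ.add (iψt.const_mul _)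
  have it2 : Integrable (fun x => 2 * k * tanh x ^ 2) sechSqMeasure := (tpow 2).const_mul _
  have it12 : Integrable (fun x => tanh x + 2 * k * tanh x ^ 2) sechSqMeasure := it.add it2
  have ipq : Integrable (fun x => (tanh x + 2 * k * tanh x ^ 2 + 3 * k ^ 2 * tanh x ^ 3) +
      (ψ x + 2 * k * (ψ x * tanh x))) sechSqMeasure := ip.add iq
  have e : 4 / 3 * k + (∫ x, ψ x ∂sechSqMeasure) + 2 * k * ∫ x, ψ x * tanh x ∂sechSqMeasure =
      ∫ x, (tanh x + 2 * k * tanh x ^ 2 + 3 * k ^ 2 * tanh x ^ 3) +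
        (ψ x + 2 * k * (ψ x * tanh x)) ∂sechSqMeasure := by
    rw [integral_add ip iq, integral_add it12 ((tpow 3).const_mul _),
      integral_add it it2, integral_add iψ (iψt.const_mul _),
      integral_const_mul, integral_const_mul, integral_const_mul, integral_tanh_sechSqMeasure,
      integral_tanh_sq_sechSqMeasure, integral_tanh_cube_sechSqMeasure]
    ring
  rw [e, centerFun, ← integral_sub (integrable_centerFun_integrand hψ hδ hk) ipq]
  refine (abs_integral_sechSqMeasure_le (B := 22 * |k| ^ 3 + δ * (16 * k ^ 2))
    fun x => ?_).trans_eq (by ring)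
  set t := tanh x with ht
  set u := t * k with hu
  have huk : |u| ≤ |k| := abs_tanh_mul_le x k
  have hu2 : |u| ≤ 1 / 2 := huk.trans hk
  obtain ⟨hul, hur⟩ := abs_le.1 hu2
  have hne : 1 - u ≠ 0 := by linarith
  have hinv : |1 / (1 - u) ^ 2| ≤ 4 := by
    rw [abs_of_nonneg (by positivity), div_le_iff₀ (by nlinarith)]
    nlinarith
  have hsplit : (t + ψ x) * (1 / (1 - u) ^ 2) -
      ((t + 2 * k * t ^ 2 + 3 * k ^ 2 * t ^ 3) + (ψ x + 2 * k * (ψ x * t))) =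
      t * (u ^ 3 * (4 - 3 * u) * (1 / (1 - u) ^ 2)) +
        ψ x * (u ^ 2 * (3 - 2 * u) * (1 / (1 - u) ^ 2)) := by
    have e1 : t + 2 * k * t ^ 2 + 3 * k ^ 2 * t ^ 3 = t * (1 + 2 * u + 3 * u ^ 2) := by
      rw [hu]; ring
    have e2 : ψ x + 2 * k * (ψ x * t) = ψ x * (1 + 2 * u) := by rw [hu]; ring
    rw [e1, e2]
    clear_value u
    field_simp
    ring
  rw [hsplit]
  have b1 : |u ^ 3 * (4 - 3 * u) * (1 / (1 - u) ^ 2)| ≤ 22 * |k| ^ 3 := by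
    rw [abs_mul, abs_mul, abs_pow]
    have h1 : |u| ^ 3 ≤ |k| ^ 3 := pow_le_pow_left₀ (abs_nonneg u) huk 3
    have h2 : |4 - 3 * u| ≤ 11 / 2 := abs_le.2 ⟨by linarith, by linarith⟩
    calc _ ≤ |k| ^ 3 * (11 / 2) * 4 := by gcongr
      _ = _ := by ring
  have b2 : |u ^ 2 * (3 - 2 * u) * (1 / (1 - u) ^ 2)| ≤ 16 * k ^ 2 := by
    rw [abs_mul, abs_mul, abs_pow]
    have h1 : |u| ^ 2 ≤ |k| ^ 2 := pow_le_pow_left₀ (abs_nonneg u) huk 2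
    have h2 : |3 - 2 * u| ≤ 4 := abs_le.2 ⟨by linarith, by linarith⟩
    calc _ ≤ |k| ^ 2 * 4 * 4 := by gcongr
      _ = _ := by rw [sq_abs]; ring
  refine (abs_add_le _ _).trans (add_le_add ?_ ?_)
  · rw [abs_mul]
    exact (mul_le_of_le_one_left (abs_nonneg _) (abs_tanh_lt_one x).le).trans b1
  · rw [abs_mul]
    exact mul_le_mul (hδ x) b2 (abs_nonneg _) hδ0

theorem abs_artanh_sub_le (hk : |k| ≤ 1 / 2) : |artanh k - k| ≤ 2 * |k| ^ 3 := by
  have hk1 : |k| < 1 := by linarith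
  obtain ⟨hl, hr⟩ := abs_le.1 hk
  have h1 := abs_log_sub_add_sum_range_le hk1 2
  have h2 := abs_log_sub_add_sum_range_le (x := -k) (by rwa [abs_neg]) 2
  rw [abs_neg] at h2
  have h3 : |k| ^ (2 + 1) / (1 - |k|) ≤ 2 * |k| ^ 3 := by
    rw [div_le_iff₀ (by linarith)]
    have h : 0 ≤ |k| ^ 3 * (1 - 2 * |k|) := mul_nonneg (by positivity) (by linarith)
    norm_num
    linarith
  have h1' := abs_le.1 (h1.trans h3)
  have h2' := abs_le.1 (h2.trans h3)
  simp only [Finset.sum_range_succ, Finset.sum_range_zero, sub_neg_eq_add] at h1' h2'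
  norm_num at h1' h2'
  rw [artanh_eq_half_log ⟨by linarith, by linarith⟩,
    log_div (by linarith) (by linarith)]
  exact abs_le.2 ⟨by linarith [h1'.1, h1'.2, h2'.1, h2'.2],
    by linarith [h1'.1, h1'.2, h2'.1, h2'.2]⟩

theorem abs_sub_expansion_le {a b : ℝ} (hδ0 : 0 ≤ δ) (hδ₀ : δ ≤ 1 / 400) (hb : |b| ≤ 4 * δ)
    (hk : |k| ≤ 3 * δ) (h : |4 / 3 * k + a - b * k| ≤ 44 * |k| ^ 3 + 32 * δ * k ^ 2) :
    |k - (-(3 / 4) * a - 9 / 16 * a * b)| ≤ 1900 * δ ^ 3 := by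
  have hk3 : |k| ^ 3 ≤ (3 * δ) ^ 3 := pow_le_pow_left₀ (abs_nonneg k) hk 3
  have hk2 : k ^ 2 ≤ (3 * δ) ^ 2 := sq_le_sq' (abs_le.1 hk).1 (abs_le.1 hk).2
  have hE : |4 / 3 * k + a - b * k| ≤ 1476 * δ ^ 3 := by
    nlinarith [mul_le_mul_of_nonneg_left hk2 hδ0]
  set E := 4 / 3 * k + a - b * k with hEdef
  have e : k - (-(3 / 4) * a - 9 / 16 * a * b) =
      9 / 16 * (b * b * k) + 3 / 4 * E + 9 / 16 * (b * E) := by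
    rw [hEdef]; ring
  have h1 : |b * b * k| ≤ 4 * δ * (4 * δ) * (3 * δ) := by
    rw [abs_mul, abs_mul]; gcongr
  have h2 : |b * E| ≤ 4 * δ * (1476 * δ ^ 3) := by
    rw [abs_mul]; gcongr
  have h3 : δ * δ ^ 3 ≤ 1 / 400 * δ ^ 3 := by gcongr
  have hδ3 : 0 ≤ δ ^ 3 := by positivity
  rw [e]
  have h1' := abs_le.1 h1
  have h2' := abs_le.1 h2
  have hE' := abs_le.1 hE
  exact abs_le.2 ⟨by nlinarith [h1'.1, h2'.1, hE'.1], by nlinarith [h1'.2, h2'.2, hE'.2]⟩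

end

theorem integral_center_translate (m : ℝ → ℝ) (x₀ ζ : ℝ) :
    ∫ x, (m x - tanh (x - ζ)) * (1 / cosh (x - ζ) ^ 2) =
      ∫ x, (tanh x + (m (x + x₀) - tanh x) - tanh (x - (ζ - x₀))) *
        (1 / cosh (x - (ζ - x₀)) ^ 2) := by
  rw [← integral_add_right_eq_self (fun x => (m x - tanh (x - ζ)) * (1 / cosh (x - ζ) ^ 2)) x₀]
  refine integral_congr_ae (ae_of_all _ fun x => ?_)
  simp only [add_sub_cancel, show x + x₀ - ζ = x - (ζ - x₀) by ring]

theorem pairing₁_eq (m : ℝ → ℝ) (x₀ : ℝ) :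
    pairing₁ m x₀ = ∫ x, (m (x + x₀) - tanh x) ∂sechSqMeasure := by
  rw [integral_sechSqMeasure, pairing₁, ← integral_add_right_eq_self _ x₀]
  simp only [add_sub_cancel_right]

theorem pairing₂_eq (m : ℝ → ℝ) (x₀ : ℝ) :
    pairing₂ m x₀ = -2 * ∫ x, (m (x + x₀) - tanh x) * tanh x ∂sechSqMeasure := by
  rw [integral_sechSqMeasure, pairing₂, ← integral_add_right_eq_self _ x₀, ← integral_const_mul]
  refine integral_congr_ae (ae_of_all _ fun x => ?_)
  simp only [add_sub_cancel_right]
  ring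

/-- Expansion of the center: there are `δ₀ > 0` and `C > 0` such that for every continuous
`m` with `δ := sup_x |m(x) − tanh(x−x₀)| ≤ δ₀`, the unique center `ζ` of `m` (the unique
`ζ` with `∫ (m(x) − tanh(x−ζ)) sech²(x−ζ) dx = 0`) satisfies
`ζ = x₀ − (3/4)⟨m−m̄_{x₀}, m̄'_{x₀}⟩ − (9/16)⟨m−m̄_{x₀}, m̄'_{x₀}⟩⟨m−m̄_{x₀}, m̄''_{x₀}⟩ + R`
with `|R| ≤ C δ³`. -/
theorem center_expansion :
    ∃ δ₀ > (0 : ℝ), ∃ C > (0 : ℝ),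
      ∀ (x₀ : ℝ) (m : ℝ → ℝ) (δ : ℝ), Continuous m → δ ≤ δ₀ →
        (∀ x : ℝ, |m x - Real.tanh (x - x₀)| ≤ δ) →
        ∃ ζ : ℝ,
          (∫ x : ℝ, (m x - Real.tanh (x - ζ)) * (1 / Real.cosh (x - ζ) ^ 2)) = 0 ∧
          (∀ ζ' : ℝ,
            (∫ x : ℝ, (m x - Real.tanh (x - ζ')) * (1 / Real.cosh (x - ζ') ^ 2)) = 0 →
            ζ' = ζ) ∧
          |ζ - (x₀ - (3 / 4) * pairing₁ m x₀
              - (9 / 16) * pairing₁ m x₀ * pairing₂ m x₀)| ≤ C * δ ^ 3 := by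
  refine ⟨1 / 400, by norm_num, 2000, by norm_num, fun x₀ m δ hm hδ₀ hδ => ?_⟩
  have hδ0 : 0 ≤ δ := (abs_nonneg _).trans (hδ 0)
  set ψ : ℝ → ℝ := fun x => m (x + x₀) - tanh x with hψdef
  have hψ : Continuous ψ := (hm.comp (continuous_add_const x₀)).sub continuous_tanh
  have hψδ : ∀ x, |ψ x| ≤ δ := fun x => by simpa using hδ (x + x₀)
  have center : ∀ ζ : ℝ, (∫ x : ℝ, (m x - tanh (x - ζ)) * (1 / cosh (x - ζ) ^ 2)) =
      (1 - tanh (ζ - x₀) ^ 2) * centerFun ψ (tanh (ζ - x₀)) := fun ζ => by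
    rw [integral_center_translate m x₀ ζ]
    exact integral_center_eq_centerFun hψ hψδ (ζ - x₀)
  have small : ∀ ζ : ℝ, (∫ x : ℝ, (m x - tanh (x - ζ)) * (1 / cosh (x - ζ) ^ 2)) = 0 →
      |tanh (ζ - x₀)| ≤ 3 * δ := fun ζ hζ => by
    rw [integral_center_translate m x₀ ζ] at hζ
    exact abs_tanh_le_of_integral_center_eq_zero hψ hψδ hζ
  obtain ⟨k, hk, hk0⟩ := exists_centerFun_eq_zero hψ hψδ hδ₀
  have hkmem : k ∈ Set.Ioo (-1 : ℝ) 1 := abs_lt.1 (by linarith)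
  have htk : tanh (x₀ + artanh k - x₀) = k := by
    rw [add_sub_cancel_left, tanh_artanh hkmem]
  have hzero : (∫ x : ℝ, (m x - tanh (x - (x₀ + artanh k))) *
      (1 / cosh (x - (x₀ + artanh k)) ^ 2)) = 0 := by
    rw [center, htk, hk0, mul_zero]
  refine ⟨x₀ + artanh k, hzero, fun ζ' hζ' => ?_, ?_⟩
  · have hsmall := small ζ' hζ'
    have hne : 1 - tanh (ζ' - x₀) ^ 2 ≠ 0 := by linarith [tanh_sq_lt_one (ζ' - x₀)]
    have h0 : centerFun ψ (tanh (ζ' - x₀)) = 0 :=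
      (mul_eq_zero.1 ((center ζ').symm.trans hζ')).resolve_left hne
    have := centerFun_injOn hψ hψδ hδ₀ (by linarith) hk (h0.trans hk0.symm)
    rw [← this, artanh_tanh]
    ring
  · have hk3 : |k| ≤ 3 * δ := htk ▸ small _ hzero
    have hexp := abs_centerFun_sub_le hψ hψδ hk
    have hp₁ : pairing₁ m x₀ = ∫ x, ψ x ∂sechSqMeasure := pairing₁_eq m x₀
    have hp₂ : pairing₂ m x₀ = -2 * ∫ x, ψ x * tanh x ∂sechSqMeasure := pairing₂_eq m x₀
    have hb : |pairing₂ m x₀| ≤ 4 * δ := by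
      have := abs_integral_sechSqMeasure_le (g := fun x => ψ x * tanh x) (B := δ) fun x => by
        rw [abs_mul]
        nlinarith [hψδ x, abs_tanh_lt_one x, abs_nonneg (ψ x), abs_nonneg (tanh x)]
      rw [hp₂, abs_mul]
      norm_num
      linarith
    have hmain := abs_sub_expansion_le (a := pairing₁ m x₀) hδ0 hδ₀ hb hk3 (by
      rw [hk0, zero_sub, abs_neg] at hexp
      convert! hexp using 2
      rw [hp₁, hp₂]
      ring)
    have hart := abs_artanh_sub_le hk
    have hcube : |k| ^ 3 ≤ (3 * δ) ^ 3 := pow_le_pow_left₀ (abs_nonneg k) hk3 3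
    have e : x₀ + artanh k - (x₀ - 3 / 4 * pairing₁ m x₀ -
        9 / 16 * pairing₁ m x₀ * pairing₂ m x₀) = (artanh k - k) +
        (k - (-(3 / 4) * pairing₁ m x₀ - 9 / 16 * pairing₁ m x₀ * pairing₂ m x₀)) := by ring
    rw [e]
    refine (abs_add_le _ _).trans ?_
    nlinarith [pow_nonneg hδ0 3]
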